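/- Let n ≥ 6 and let B be a saturated blocker of size n−1 of the convex n-gon. Then there exists a vertex i with deg_B(i) = 2 such that the ear-cover {i−1,i+1} does not belong to B. -/

import Mathlib

open Finset

namespace ConvexBlocker

/-- `c` lies strictly inside the (positively oriented) open arc from `a` to `b`. -/
def Btw (n : ℕ) (a c b : ZMod n) : Prop :=
  0 < (c - a).val ∧ (c - a).val < (b - a).val

/-- Two edges of the convex `n`-gon cross: their endpoints are four pairwise distinct
vertices which interleave in the cyclic order. -/
def Cross (n : ℕ) (e f : Sym2 (ZMod n)) : Prop :=
  ∃ a b c d : ZMod n, e = s(a, b) ∧ f = s(c, d) ∧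
    0 < (c - a).val ∧ (c - a).val < (b - a).val ∧ (b - a).val < (d - a).val

/-- `e` is an edge (an unordered pair of distinct vertices) of the `n`-gon. -/
def IsEdge (n : ℕ) (e : Sym2 (ZMod n)) : Prop :=
  ∃ a b : ZMod n, e = s(a, b) ∧ a ≠ b

/-- `e` is a diagonal of the convex `n`-gon: an edge of order at least 2, i.e. both open
arcs between its endpoints are nonempty. -/
def IsDiagonal (n : ℕ) (e : Sym2 (ZMod n)) : Prop :=
  ∃ a b : ZMod n, e = s(a, b) ∧ a ≠ b ∧ (∃ c, Btw n a c b) ∧ (∃ d, Btw n b d a)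

/-- A triangulation of the convex `n`-gon: an inclusion-maximal set of pairwise
non-crossing diagonals. -/
def IsTriangulation (n : ℕ) (T : Finset (Sym2 (ZMod n))) : Prop :=
  (∀ e ∈ T, IsDiagonal n e) ∧
  (∀ e ∈ T, ∀ f ∈ T, ¬ Cross n e f) ∧
  (∀ e, IsDiagonal n e → e ∉ T → ∃ f ∈ T, Cross n e f)

/-- A blocker of the convex `n`-gon: a set of edges meeting every triangulation. -/
def IsBlocker (n : ℕ) (B : Finset (Sym2 (ZMod n))) : Prop :=
  (∀ e ∈ B, IsEdge n e) ∧
  ∀ T : Finset (Sym2 (ZMod n)), IsTriangulation n T → (B ∩ T).Nonempty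

/-- A saturated blocker of the convex `n`-gon. -/
def IsSaturatedBlocker (n : ℕ) (B : Finset (Sym2 (ZMod n))) : Prop :=
  IsBlocker n B ∧ ∀ e ∈ B, ¬ IsBlocker n (B.erase e)

/-- `e` is an edge of the sub-polygon on the vertex set `S`. -/
def IsEdgeOn (n : ℕ) (S : Finset (ZMod n)) (e : Sym2 (ZMod n)) : Prop :=
  ∃ a b : ZMod n, e = s(a, b) ∧ a ∈ S ∧ b ∈ S ∧ a ≠ b

/-- `e` is a diagonal of the sub-polygon on `S` (with the inherited cyclic order):
its endpoints are distinct members of `S` which are not cyclically consecutive in `S`. -/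
def IsDiagonalOn (n : ℕ) (S : Finset (ZMod n)) (e : Sym2 (ZMod n)) : Prop :=
  ∃ a b : ZMod n, e = s(a, b) ∧ a ∈ S ∧ b ∈ S ∧ a ≠ b ∧
    (∃ c ∈ S, Btw n a c b) ∧ (∃ d ∈ S, Btw n b d a)

/-- A triangulation of the sub-polygon on `S`. -/
def IsTriangulationOn (n : ℕ) (S : Finset (ZMod n)) (T : Finset (Sym2 (ZMod n))) : Prop :=
  (∀ e ∈ T, IsDiagonalOn n S e) ∧
  (∀ e ∈ T, ∀ f ∈ T, ¬ Cross n e f) ∧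
  (∀ e, IsDiagonalOn n S e → e ∉ T → ∃ f ∈ T, Cross n e f)

/-- A blocker of the sub-polygon on `S`. -/
def IsBlockerOn (n : ℕ) (S : Finset (ZMod n)) (B : Finset (Sym2 (ZMod n))) : Prop :=
  (∀ e ∈ B, IsEdgeOn n S e) ∧
  ∀ T : Finset (Sym2 (ZMod n)), IsTriangulationOn n S T → (B ∩ T).Nonempty

/-- A saturated blocker of the sub-polygon on `S`. -/
def IsSaturatedBlockerOn (n : ℕ) (S : Finset (ZMod n)) (B : Finset (Sym2 (ZMod n))) : Prop :=
  IsBlockerOn n S B ∧ ∀ e ∈ B, ¬ IsBlockerOn n S (B.erase e)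

/-- The degree of the vertex `v` in the set of edges `B`. -/
noncomputable def degB (n : ℕ) (B : Finset (Sym2 (ZMod n))) (v : ZMod n) : ℕ :=
  (B.filter (fun e => v ∈ e)).card

end ConvexBlocker

namespace ConvexBlocker

section CyclicOrder

variable {n : ℕ}

theorem Btw.ne_left {a b c : ZMod n} (h : Btw n a b c) : b ≠ a := by
  rintro rfl
  simp [Btw] at h

theorem Btw.ne_right {a b c : ZMod n} (h : Btw n a b c) : b ≠ c := by
  rintro rfl
  simp [Btw] at h

theorem Btw.ne_ends {a b c : ZMod n} (h : Btw n a b c) : a ≠ c := by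
  rintro rfl
  simp [Btw] at h

theorem btw_add_natCast {a : ZMod n} {i j k : ℕ} (hij : i < j) (hjk : j < k) (hki : k < n + i) :
    Btw n (a + i) (a + j) (a + k) := by
  have e1 : a + (j : ZMod n) - (a + i) = ((j - i : ℕ) : ZMod n) := by
    rw [Nat.cast_sub hij.le]; ring
  have e2 : a + (k : ZMod n) - (a + i) = ((k - i : ℕ) : ZMod n) := by
    rw [Nat.cast_sub (hij.trans hjk).le]; ring
  rw [Btw, e1, e2, ZMod.val_natCast_of_lt (by omega), ZMod.val_natCast_of_lt (by omega)]
  omega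

theorem isDiagonalOn_mk_iff {S : Finset (ZMod n)} {x y : ZMod n} :
    IsDiagonalOn n S s(x, y) ↔
      x ∈ S ∧ y ∈ S ∧ (∃ c ∈ S, Btw n x c y) ∧ ∃ d ∈ S, Btw n y d x := by
  constructor
  · rintro ⟨a, b, he, ha, hb, -, h⟩
    rw [Sym2.eq_iff] at he
    obtain ⟨rfl, rfl⟩ | ⟨rfl, rfl⟩ := he <;> tauto
  · rintro ⟨hx, hy, ⟨c, hc, hxcy⟩, hd⟩
    exact ⟨x, y, rfl, hx, hy, hxcy.ne_ends, ⟨c, hc, hxcy⟩, hd⟩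

variable [NeZero n]

theorem btw_iff (o x y z : ZMod n) :
    Btw n x y z ↔
      ((x - o).val < (y - o).val ∧ (y - o).val < (z - o).val) ∨
      ((y - o).val < (z - o).val ∧ (z - o).val < (x - o).val) ∨
      ((z - o).val < (x - o).val ∧ (x - o).val < (y - o).val) := by
  have key : ∀ u : ZMod n, (u - x).val + (x - o).val = (u - o).val ∨
      (u - x).val + (x - o).val = (u - o).val + n := by
    intro u
    have h := ZMod.val_add (u - x) (x - o)
    rw [sub_add_sub_cancel] at h
    have h1 := ZMod.val_lt (u - x)
    have h2 := ZMod.val_lt (x - o)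
    by_cases hlt : (u - x).val + (x - o).val < n
    · rw [Nat.mod_eq_of_lt hlt] at h
      omega
    · rw [Nat.mod_eq_sub_mod (by omega), Nat.mod_eq_of_lt (by omega)] at h
      omega
  have hy := key y
  have hz := key z
  have h1 := ZMod.val_lt (y - x)
  have h2 := ZMod.val_lt (z - x)
  have h3 := ZMod.val_lt (y - o)
  have h4 := ZMod.val_lt (z - o)
  have h5 := ZMod.val_lt (x - o)
  unfold Btw
  omega

theorem val_sub_eq_iff (o x y : ZMod n) : (x - o).val = (y - o).val ↔ x = y := by
  rw [(ZMod.val_injective n).eq_iff, sub_left_inj]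

theorem Btw.rotate {a b c : ZMod n} (h : Btw n a b c) : Btw n b c a := by
  rw [btw_iff a] at h ⊢
  omega

theorem cross_mk_iff {a b c d : ZMod n} :
    Cross n s(a, b) s(c, d) ↔
      (Btw n a c b ∧ Btw n b d a) ∨ (Btw n a d b ∧ Btw n b c a) := by
  have key : ∀ a b c d : ZMod n, (0 < (c - a).val ∧ (c - a).val < (b - a).val ∧
      (b - a).val < (d - a).val) ↔ (Btw n a c b ∧ Btw n b d a) := by
    intro a b c d
    rw [btw_iff a, btw_iff a]
    simp only [sub_self, ZMod.val_zero]
    omega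
  constructor
  · rintro ⟨a', b', c', d', he, hf, h⟩
    rw [key] at h
    rw [Sym2.eq_iff] at he hf
    obtain ⟨rfl, rfl⟩ | ⟨rfl, rfl⟩ := he <;> obtain ⟨rfl, rfl⟩ | ⟨rfl, rfl⟩ := hf <;> tauto
  · rintro (h | h)
    · exact ⟨a, b, c, d, rfl, rfl, (key _ _ _ _).2 h⟩
    · exact ⟨a, b, d, c, rfl, Sym2.eq_swap, (key _ _ _ _).2 h⟩

theorem Cross.symm {e f : Sym2 (ZMod n)} (h : Cross n e f) : Cross n f e := by
  induction e with | _ a b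
  induction f with | _ c d
  rw [cross_mk_iff] at h ⊢
  simp only [btw_iff a] at h ⊢
  omega

theorem not_cross_self (e : Sym2 (ZMod n)) : ¬ Cross n e e := by
  induction e with | _ a b
  rw [cross_mk_iff]
  simp only [btw_iff a]
  omega

theorem isTriangulationOn_univ {T : Finset (Sym2 (ZMod n))} :
    IsTriangulationOn n Finset.univ T ↔ IsTriangulation n T := by
  simp [IsTriangulationOn, IsTriangulation, IsDiagonalOn, IsDiagonal]

theorem isDiagonal_mk_iff {x y : ZMod n} :
    IsDiagonal n s(x, y) ↔ (∃ c, Btw n x c y) ∧ ∃ d, Btw n y d x := by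
  have h := isDiagonalOn_mk_iff (S := Finset.univ) (x := x) (y := y)
  simpa [IsDiagonalOn, IsDiagonal] using h

end CyclicOrder

section Ears

variable {n : ℕ} [NeZero n]

/-- Gluing an ear onto a triangulated sub-polygon gives a triangulated sub-polygon. -/
theorem IsTriangulationOn.insert_ear {S : Finset (ZMod n)} {T : Finset (Sym2 (ZMod n))}
    (hT : IsTriangulationOn n S T) {a b c d : ZMod n} (ha : a ∈ S) (hc : c ∈ S) (hd : d ∈ S)
    (habc : Btw n a b c) (hcda : Btw n c d a) (hside : ∀ s ∈ S, ¬ Btw n a s c) :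
    IsTriangulationOn n (insert b S) (insert s(a, c) T) := by
  obtain ⟨hdiag, hcross, hmax⟩ := hT
  have hear : ∀ e ∈ T, ¬ Cross n s(a, c) e := by
    intro e he
    have h := hdiag e he
    induction e with | _ x y
    obtain ⟨hx, hy, -⟩ := isDiagonalOn_mk_iff.1 h
    have h1 := hside x hx
    have h2 := hside y hy
    rw [cross_mk_iff]
    tauto
  refine ⟨?_, ?_, ?_⟩
  · intro e he
    rcases Finset.mem_insert.1 he with rfl | he
    · exact isDiagonalOn_mk_iff.2 ⟨by simp [ha], by simp [hc], ⟨b, by simp, habc⟩,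
        ⟨d, by simp [hd], hcda⟩⟩
    · have h := hdiag e he
      induction e with | _ x y
      rw [isDiagonalOn_mk_iff] at h ⊢
      obtain ⟨hx, hy, ⟨p, hp, hp'⟩, q, hq, hq'⟩ := h
      exact ⟨by simp [hx], by simp [hy], ⟨p, by simp [hp], hp'⟩, q, by simp [hq], hq'⟩
  · intro e he f hf
    rcases Finset.mem_insert.1 he with rfl | he <;> rcases Finset.mem_insert.1 hf with rfl | hf
    · exact not_cross_self _
    · exact hear f hf
    · exact fun h => hear e he h.symm
    · exact hcross e he f hf
  · intro e he hnot
    rw [Finset.mem_insert, not_or] at hnot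
    obtain ⟨hne, hnT⟩ := hnot
    have hb_end : ∀ y ∈ insert b S, (∃ p ∈ insert b S, Btw n b p y) →
        (∃ q ∈ insert b S, Btw n y q b) → Cross n s(b, y) s(a, c) := by
      rintro y hy ⟨p, hp, hbpy⟩ ⟨q, hq, hyqb⟩
      have hy' : ¬ Btw n a y c := by
        rcases Finset.mem_insert.1 hy with rfl | hy
        · exact absurd rfl hbpy.ne_ends
        · exact hside y hy
      have hp' := hside p ((Finset.mem_insert.1 hp).resolve_left hbpy.ne_left)
      have hq' := hside q ((Finset.mem_insert.1 hq).resolve_left hyqb.ne_right)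
      rw [cross_mk_iff]
      simp only [btw_iff b] at *
      simp only [sub_self, ZMod.val_zero] at *
      omega
    have hside' : ∀ x ∈ S, ∀ y ∈ S, s(x, y) ≠ s(a, c) →
        (∃ p ∈ insert b S, Btw n x p y) → ∃ p ∈ S, Btw n x p y := by
      rintro x hx y hy hxy ⟨p, hp, hxpy⟩
      rcases Finset.mem_insert.1 hp with rfl | hp
      · have h1 := hside x hx
        have h2 := hside y hy
        by_contra hcon
        push Not at hcon
        have h3 := hcon a ha
        have h4 := hcon c hc
        apply hxy
        have : x = a ∧ y = c := by
          rw [← val_sub_eq_iff p x a, ← val_sub_eq_iff p y c]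
          simp only [btw_iff p] at *
          simp only [sub_self, ZMod.val_zero] at *
          omega
        rw [this.1, this.2]
      · exact ⟨p, hp, hxpy⟩
    induction e with | _ x y
    obtain ⟨hx, hy, hp, hq⟩ := isDiagonalOn_mk_iff.1 he
    rcases Finset.mem_insert.1 hx with rfl | hx'
    · exact ⟨_, Finset.mem_insert_self _ _, hb_end y hy hp hq⟩
    rcases Finset.mem_insert.1 hy with rfl | hy'
    · have h := hb_end x hx hq hp
      rw [Sym2.eq_swap] at h
      exact ⟨_, Finset.mem_insert_self _ _, h⟩
    obtain ⟨f, hf, hef⟩ := hmax s(x, y) (isDiagonalOn_mk_iff.2 ⟨hx', hy',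
      hside' x hx' y hy' hne hp,
      hside' y hy' x hx' (by rwa [Sym2.eq_swap]) hq⟩) hnT
    exact ⟨f, Finset.mem_insert_of_mem hf, hef⟩

/-- An ear inside the arc cut off by a diagonal of a triangulation. -/
theorem IsTriangulation.exists_ear {T : Finset (Sym2 (ZMod n))} (hT : IsTriangulation n T)
    (k : ℕ) : ∀ (p : ZMod n), 2 ≤ k → k < n → s(p, p + (k : ZMod n)) ∈ T →
    ∃ i, i + 2 ≤ k ∧ s(p + (i : ZMod n), p + ((i + 2 : ℕ) : ZMod n)) ∈ T := by
  induction k using Nat.strong_induction_on with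
  | _ k ih =>
  intro p hk hkn hmem
  rcases hk.eq_or_lt with rfl | hk
  · exact ⟨0, le_rfl, by simpa using hmem⟩
  by_cases h02 : s(p, p + ((2 : ℕ) : ZMod n)) ∈ T
  · exact ⟨0, by omega, by simpa using h02⟩
  have hval : ∀ i < n, (p + (i : ZMod n) - p).val = i := by
    intro i hi
    rw [add_sub_cancel_left, ZMod.val_natCast_of_lt hi]
  have hdiag : IsDiagonal n s(p, p + ((2 : ℕ) : ZMod n)) := by
    rw [isDiagonal_mk_iff]
    constructor
    · refine ⟨p + ((1 : ℕ) : ZMod n), ?_⟩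
      rw [Btw, hval 1 (by omega), hval 2 (by omega)]
      omega
    · refine ⟨p + ((3 : ℕ) : ZMod n), ?_⟩
      rw [btw_iff p, hval 3 (by omega), hval 2 (by omega)]
      simp
  obtain ⟨f, hf, hcr⟩ := hT.2.2 _ hdiag h02
  have key : ∀ c d : ZMod n, s(c, d) ∈ T → Btw n p c (p + ((2 : ℕ) : ZMod n)) →
      Btw n (p + ((2 : ℕ) : ZMod n)) d p →
      ∃ i, i + 2 ≤ k ∧ s(p + (i : ZMod n), p + ((i + 2 : ℕ) : ZMod n)) ∈ T := by
    intro c d hcd hc hd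
    have hnc := hT.2.1 _ hmem _ hcd
    rw [cross_mk_iff, btw_iff p p, btw_iff p _ d, btw_iff p p d, btw_iff p _ c,
      hval k hkn] at hnc
    rw [btw_iff p, hval 2 (by omega)] at hc hd
    simp only [sub_self, ZMod.val_zero] at hnc hc hd
    have hc1 : c = p + ((1 : ℕ) : ZMod n) := by
      rw [← val_sub_eq_iff p, hval 1 (by omega)]
      omega
    have hdn := ZMod.val_lt (d - p)
    obtain ⟨m, hm⟩ : ∃ m, (d - p).val = 1 + m := ⟨(d - p).val - 1, by omega⟩
    have hdm : d = c + (m : ZMod n) := by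
      rw [← val_sub_eq_iff p, hm, hc1, add_assoc, ← Nat.cast_add, hval (1 + m) (by omega)]
    obtain ⟨i, hi, hi'⟩ := ih m (by omega) c (by omega) (by omega) (by rwa [← hdm])
    refine ⟨1 + i, by omega, ?_⟩
    rw [hc1, add_assoc, add_assoc, ← Nat.cast_add, ← Nat.cast_add] at hi'
    exact hi'
  induction f with | _ c d
  rw [cross_mk_iff] at hcr
  rcases hcr with ⟨h1, h2⟩ | ⟨h1, h2⟩
  · exact key c d hf h1 h2
  · exact key d c (by rwa [Sym2.eq_swap]) h1 h2

end Ears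

section EarReduction

variable {α : Type*}

/-- The polygon with cyclic vertex sequence `l` can be cut down to a triangle by repeatedly
cutting off ears along edges outside `B`. -/
inductive EarReducible (B : Finset (Sym2 α)) : List α → Prop
  | small {l : List α} : l.length ≤ 3 → EarReducible B l
  | ear {a b c : α} {l : List α} :
      s(a, c) ∉ B → EarReducible B (a :: c :: l) → EarReducible B (a :: b :: c :: l)
  | rotate {a : α} {l : List α} : EarReducible B (l ++ [a]) → EarReducible B (a :: l)

namespace EarReducible

variable {B : Finset (Sym2 α)}

theorem append_comm {l₁ l₂ : List α} (h : EarReducible B (l₂ ++ l₁)) :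
    EarReducible B (l₁ ++ l₂) := by
  induction l₁ generalizing l₂ with
  | nil => simpa using h
  | cons a t ih =>
    refine .rotate ?_
    have h' := ih (l₂ := l₂ ++ [a]) (by simpa using h)
    simpa using h'

theorem ear_append {a b c : α} {l₁ l₂ : List α} (hac : s(a, c) ∉ B)
    (h : EarReducible B (l₁ ++ a :: c :: l₂)) : EarReducible B (l₁ ++ a :: b :: c :: l₂) :=
  append_comm (.ear hac (append_comm (l₁ := a :: c :: l₂) h))

theorem fan_append {a c : α} {l₁ l₂ : List α} (hl : ∀ w ∈ l₁, s(a, w) ∉ B) (hac : s(a, c) ∉ B)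
    (h : EarReducible B (a :: c :: l₂)) : EarReducible B (a :: (l₁ ++ c :: l₂)) := by
  induction l₁ with
  | nil => exact h
  | cons x t ih =>
    have ih' := ih fun w hw => hl w (List.mem_cons_of_mem _ hw)
    cases t with
    | nil => exact .ear hac ih'
    | cons y t => exact .ear (hl y (by simp)) ih'

theorem fan {a : α} {l : List α} (hl : ∀ w ∈ l, s(a, w) ∉ B) : EarReducible B (a :: l) := by
  rcases List.eq_nil_or_concat l with rfl | ⟨t, c, rfl⟩
  · exact .small (by simp)
  · rw [List.concat_eq_append] at hl ⊢
    exact fan_append (fun w hw => hl w (by simp [hw])) (hl c (by simp)) (.small (by simp))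

end EarReducible

/-- Either some three consecutive members of `l` form an ear whose base is not in `B`, or `B`
contains many edges on `l`. -/
theorem exists_ear_notMem_or_length_le {A B : Finset (Sym2 α)} {l : List α} (hl : l.Nodup)
    (hA : ∀ e ∈ B, (∀ v ∈ e, v ∈ l) → e ∈ A) :
    (∃ l₁ a b c l₂, l = l₁ ++ a :: b :: c :: l₂ ∧ s(a, c) ∉ B) ∨ l.length ≤ A.card + 2 := by
  classical
  induction l generalizing A with
  | nil => simp
  | cons a t ih =>
    rcases t with _ | ⟨b, _ | ⟨c, l⟩⟩
    · simp
    · simp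
    · by_cases hac : s(a, c) ∈ B
      · have ha := (List.nodup_cons.1 hl).1
        rcases ih (A := A.erase s(a, c)) hl.of_cons fun e he hel => Finset.mem_erase.2
          ⟨by rintro rfl; exact ha (hel a (by simp)),
            hA e he fun v hv => List.mem_cons_of_mem _ (hel v hv)⟩ with
          ⟨l₁, x, y, z, l₂, heq, hB⟩ | h
        · exact .inl ⟨a :: l₁, x, y, z, l₂, by rw [heq]; rfl, hB⟩
        · have hmem : s(a, c) ∈ A := hA _ hac (by simp)
          have := Finset.card_erase_add_one hmem
          rw [List.length_cons]
          omega
      · exact .inl ⟨[], a, b, c, l, rfl, hac⟩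

/-- A polygon with `m` vertices is ear reducible when at most `m - 3` of its edges are
forbidden. -/
theorem earReducible_of_card_le {A B : Finset (Sym2 α)} {l : List α} (hl : l.Nodup)
    (hA : ∀ e ∈ B, (∀ v ∈ e, v ∈ l) → e ∈ A) (hcard : A.card + 3 ≤ l.length) :
    EarReducible B l := by
  classical
  induction hm : l.length using Nat.strong_induction_on generalizing l A with
  | _ m ih =>
  subst hm
  rcases exists_ear_notMem_or_length_le hl hA with ⟨l₁, a, b, c, l₂, rfl, hac⟩ | h
  swap
  · omega
  have hperm : (l₁ ++ a :: b :: c :: l₂).Perm (b :: (l₁ ++ a :: c :: l₂)) := by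
    simpa using List.perm_middle (l₁ := l₁ ++ [a]) (a := b) (l₂ := c :: l₂)
  have hl' := List.nodup_cons.1 (hperm.nodup_iff.1 hl)
  by_cases hb : ∃ w ∈ l₁ ++ a :: b :: c :: l₂, s(b, w) ∈ B
  · obtain ⟨w, hw, hbw⟩ := hb
    refine .ear_append hac (ih _ (by simp) (A := A.erase s(b, w)) hl'.2 (fun e he hel => ?_) ?_ rfl)
    · exact Finset.mem_erase.2 ⟨by rintro rfl; exact hl'.1 (hel b (by simp)),
        hA e he fun v hv => hperm.mem_iff.2 (List.mem_cons_of_mem _ (hel v hv))⟩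
    · have hmem : s(b, w) ∈ A := by
        refine hA _ hbw fun v hv => ?_
        rcases Sym2.mem_iff.1 hv with rfl | rfl
        · simp
        · exact hw
      have := Finset.card_erase_add_one hmem
      simp only [List.length_append, List.length_cons] at hcard ⊢
      omega
  · push Not at hb
    have hfan : EarReducible B (b :: (c :: l₂ ++ (l₁ ++ [a]))) :=
      .fan fun w hw => hb w (by simp at hw ⊢; tauto)
    have := EarReducible.append_comm (l₁ := l₁ ++ [a]) (l₂ := b :: c :: l₂) (by simpa using hfan)
    simpa using this

end EarReduction

section Arcs

variable {n : ℕ}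

/-- The sequence of `k` consecutive vertices starting at `a`. -/
def arc (a : ZMod n) (k : ℕ) : List (ZMod n) :=
  (List.range k).map fun t : ℕ => a + (t : ZMod n)

theorem arc_add (a : ZMod n) (k m : ℕ) :
    arc a (k + m) = arc a k ++ arc (a + (k : ZMod n)) m := by
  simp [arc, List.range_add, Function.comp_def, add_assoc]

theorem arc_succ (a : ZMod n) (k : ℕ) : arc a (k + 1) = a :: arc (a + 1) k := by
  rw [add_comm, arc_add]
  simp [arc]

theorem length_arc (a : ZMod n) (k : ℕ) : (arc a k).length = k := by
  simp [arc]

theorem nodup_arc (a : ZMod n) {k : ℕ} (hk : k ≤ n) : (arc a k).Nodup := by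
  refine List.Nodup.map_on ?_ List.nodup_range
  intro x hx y hy hxy
  rw [List.mem_range] at hx hy
  have h := congrArg ZMod.val (add_left_cancel hxy)
  rwa [ZMod.val_natCast_of_lt (by omega), ZMod.val_natCast_of_lt (by omega)] at h

theorem triplewise_btw_arc (a : ZMod n) {k : ℕ} (hk : k ≤ n) :
    (arc a k).Triplewise (Btw n) := by
  rw [List.triplewise_iff_getElem]
  intro i j m hij hjm hm
  rw [length_arc] at hm
  simp only [arc, List.getElem_map, List.getElem_range]
  exact btw_add_natCast hij hjm (by omega)

variable [NeZero n]

theorem triplewise_btw_rotate {a : ZMod n} {l : List (ZMod n)}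
    (h : (a :: l).Triplewise (Btw n)) : (l ++ [a]).Triplewise (Btw n) := by
  rw [List.triplewise_cons] at h
  rw [List.triplewise_append]
  refine ⟨h.2, by simp, by simp, ?_⟩
  simp only [List.mem_singleton, forall_eq]
  exact h.1.imp Btw.rotate

theorem EarReducible.exists_isTriangulationOn {B : Finset (Sym2 (ZMod n))} {l : List (ZMod n)}
    (h : EarReducible B l) (hl : l.Triplewise (Btw n)) :
    ∃ T, IsTriangulationOn n l.toFinset T ∧ Disjoint B T := by
  have hsmall : ∀ l : List (ZMod n), l.length ≤ 3 →
      ∃ T, IsTriangulationOn n l.toFinset T ∧ Disjoint B T := by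
    intro l hlen
    refine ⟨∅, ⟨by simp, by simp, ?_⟩, by simp⟩
    intro e he
    exfalso
    induction e with | _ x y
    obtain ⟨hx, hy, ⟨c, hc, hxcy⟩, d, hd, hydx⟩ := isDiagonalOn_mk_iff.1 he
    have hcd : c ≠ d := by
      rintro rfl
      rw [btw_iff x] at hxcy hydx
      omega
    have hsub : ({x, y, c, d} : Finset (ZMod n)) ⊆ l.toFinset := by
      intro z hz
      simp only [Finset.mem_insert, Finset.mem_singleton] at hz
      rcases hz with rfl | rfl | rfl | rfl <;> assumption
    have hcard := Finset.card_le_card hsub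
    rw [Finset.card_insert_of_notMem (by
        simp [hxcy.ne_ends, hxcy.ne_left.symm, hydx.ne_right.symm]),
      Finset.card_insert_of_notMem (by simp [hxcy.ne_right.symm, hydx.ne_left.symm]),
      Finset.card_pair hcd] at hcard
    have := l.toFinset_card_le
    omega
  induction h with
  | small hlen => exact hsmall _ hlen
  | @ear a b c l hac _ ih =>
    cases l with
    | nil => exact hsmall _ (by simp)
    | cons d l =>
      simp only [List.triplewise_cons, List.pairwise_cons] at hl ih
      obtain ⟨⟨hab, hacl, hll⟩, ⟨hbc, -⟩, hcl, hrest⟩ := hl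
      obtain ⟨T, hT, hBT⟩ := ih ⟨⟨hacl, hll⟩, hcl, hrest⟩
      have hT' := hT.insert_ear (a := a) (b := b) (c := c) (d := d) (by simp) (by simp) (by simp)
        (hab c (by simp)) (hacl d (by simp)).rotate ?_
      · refine ⟨_, ?_, Finset.disjoint_insert_right.2 ⟨hac, hBT⟩⟩
        rwa [List.toFinset_cons, Finset.insert_comm, ← List.toFinset_cons,
          ← List.toFinset_cons] at hT'
      · intro s hs hbtw
        rw [List.mem_toFinset, List.mem_cons, List.mem_cons] at hs
        rcases hs with rfl | rfl | hs
        · exact hbtw.ne_left rfl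
        · exact hbtw.ne_right rfl
        · have h2 := hacl s hs
          unfold Btw at h2 hbtw
          omega
  | @rotate a l _ ih =>
    obtain ⟨T, hT, hBT⟩ := ih (triplewise_btw_rotate hl)
    refine ⟨T, ?_, hBT⟩
    convert hT using 1
    ext x
    simp

theorem mem_arc {a w : ZMod n} {k : ℕ} (hk : k ≤ n) : w ∈ arc a k ↔ (w - a).val < k := by
  simp only [arc, List.mem_map, List.mem_range]
  constructor
  · rintro ⟨t, ht, rfl⟩
    rwa [add_sub_cancel_left, ZMod.val_natCast_of_lt (by omega)]
  · intro h
    exact ⟨_, h, by simp⟩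

theorem toFinset_arc_self (a : ZMod n) : (arc a n).toFinset = Finset.univ := by
  ext w
  simp [mem_arc, ZMod.val_lt]

theorem IsBlocker.not_earReducible {B : Finset (Sym2 (ZMod n))} (hB : IsBlocker n B)
    (a : ZMod n) : ¬ EarReducible B (arc a n) := by
  intro h
  obtain ⟨T, hT, hBT⟩ := h.exists_isTriangulationOn (triplewise_btw_arc a le_rfl)
  rw [toFinset_arc_self, isTriangulationOn_univ] at hT
  exact (hB.2 T hT).ne_empty (Finset.disjoint_iff_inter_eq_empty.1 hBT)

end Arcs

section Blockers

variable {n : ℕ} {B : Finset (Sym2 (ZMod n))}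

theorem IsSaturatedBlocker.exists_triangulation (hB : IsSaturatedBlocker n B)
    {f : Sym2 (ZMod n)} (hf : f ∈ B) :
    ∃ T, IsTriangulation n T ∧ f ∈ T ∧ ∀ e ∈ B, e ∈ T → e = f := by
  have h := hB.2 f hf
  simp only [IsBlocker, not_and, not_forall] at h
  obtain ⟨T, hT, hne⟩ := h fun e he => hB.1.1 e (Finset.mem_of_mem_erase he)
  have huniq : ∀ e ∈ B, e ∈ T → e = f := by
    intro e he heT
    by_contra hef
    exact hne ⟨e, by simp [hef, he, heT]⟩
  obtain ⟨e, he⟩ := hB.1.2 T hT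
  rw [Finset.mem_inter] at he
  obtain rfl := huniq e he.1 he.2
  exact ⟨T, hT, he.2, huniq⟩

theorem IsSaturatedBlocker.isDiagonal (hB : IsSaturatedBlocker n B)
    {f : Sym2 (ZMod n)} (hf : f ∈ B) : IsDiagonal n f := by
  obtain ⟨T, hT, hfT, -⟩ := hB.exists_triangulation hf
  exact hT.1 f hfT

variable [NeZero n]

theorem IsSaturatedBlocker.two_le_val_sub (hB : IsSaturatedBlocker n B) {v w : ZMod n}
    (h : s(v, w) ∈ B) : 2 ≤ (w - v).val ∧ (w - v).val + 2 ≤ n := by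
  obtain ⟨⟨c, hc⟩, d, hd⟩ := isDiagonal_mk_iff.1 (hB.isDiagonal h)
  rw [btw_iff v] at hc hd
  simp only [sub_self, ZMod.val_zero] at hc hd
  have := ZMod.val_lt (d - v)
  omega

theorem IsBlocker.exists_mem (hB : IsBlocker n B) (v : ZMod n) : ∃ w, s(v, w) ∈ B := by
  by_contra! h
  obtain ⟨m, rfl⟩ : ∃ m, n = m + 1 := Nat.exists_eq_succ_of_ne_zero (NeZero.ne n)
  apply hB.not_earReducible v
  rw [arc_succ]
  exact .fan fun w _ => h w

/-- An uncovered vertex has degree at most `|B| - n + 3`. -/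
theorem IsBlocker.degB_add_le (hB : IsBlocker n B) (hn : 4 ≤ n) {v : ZMod n}
    (hv : s(v - 1, v + 1) ∉ B) : degB n B v + n ≤ B.card + 3 := by
  classical
  by_contra! hlt
  obtain ⟨m, rfl⟩ : ∃ m, n = m + 3 := ⟨n - 3, by omega⟩
  have hred : EarReducible B (arc (v + 1) (m + 2)) := by
    refine earReducible_of_card_le (A := B.filter fun e => v ∉ e) (nodup_arc _ (by omega))
      (fun e he hel => Finset.mem_filter.2 ⟨he, fun hve => ?_⟩) ?_
    · have hmem := hel v hve
      rw [mem_arc (by omega), sub_add_cancel_left, ZMod.val_neg_one] at hmem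
      omega
    · have hsplit := Finset.card_filter_add_card_filter_not (s := B) fun e => v ∈ e
      unfold degB at hlt
      rw [length_arc]
      omega
  apply hB.not_earReducible (v - 1)
  have hlast : arc (v + 1) (m + 2) = arc (v + 1) (m + 1) ++ [v - 1] := by
    rw [arc_add _ (m + 1) 1]
    congr 1
    have h0 := ZMod.natCast_self (m + 3)
    push_cast at h0
    simp only [arc, List.range_one, List.map_cons, List.map_nil, Nat.cast_zero, add_zero,
      List.cons.injEq, and_true]
    push_cast
    linear_combination h0
  rw [arc_succ, sub_add_cancel, arc_succ, arc_succ]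
  refine .ear hv (.rotate ?_)
  rw [hlast, arc_succ] at hred
  exact hred

/-- If `v` is joined in `B` only to `j`, then `B` covers `j`. -/
theorem IsSaturatedBlocker.covers_of_unique (hB : IsSaturatedBlocker n B) {v j : ZMod n}
    (hj : s(v, j) ∈ B) (huniq : ∀ w, s(v, w) ∈ B → w = j) : s(j - 1, j + 1) ∈ B := by
  by_contra hcov
  obtain ⟨h1, h2⟩ := hB.two_le_val_sub hj
  obtain ⟨k, hk⟩ : ∃ k, (j - v).val = k + 2 := ⟨(j - v).val - 2, by omega⟩
  obtain ⟨m, hm⟩ : ∃ m, n = k + (m + 1 + 1 + 1) + 1 := ⟨n - (k + 4), by omega⟩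
  have hjv : j = v + 1 + (k : ZMod n) + 1 := by
    have h := ZMod.natCast_zmod_val (j - v)
    rw [hk] at h
    push_cast at h
    linear_combination -h
  have hlist : arc v n = (v :: arc (v + 1) k) ++ (j - 1) :: j :: (j + 1) :: arc (j + 1 + 1) m := by
    refine (congrArg (arc v) hm).trans ?_
    rw [arc_succ, arc_add, arc_succ, arc_succ, arc_succ, ← hjv, hjv, add_sub_cancel_right]
    rfl
  apply hB.1.not_earReducible v
  have hnd := nodup_arc v le_rfl
  rw [hlist] at hnd ⊢
  refine .ear_append hcov ?_
  rw [List.cons_append]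
  refine .fan fun w hw hvw => ?_
  obtain rfl := huniq w hvw
  simp only [List.nodup_append, List.nodup_cons, List.mem_cons, List.mem_append] at hnd hw
  grind

/-- Two vertices whose edges in `B` lie on opposite sides of the line through them cannot
exist, when these edges are met first on walking backwards. -/
theorem IsBlocker.false_of_opposite_sides (hB : IsBlocker n B) {x y : ZMod n} (hxy : x ≠ y)
    (hx : ∀ w, s(x, w) ∈ B → Btw n y w x) (hy : ∀ w, s(y, w) ∈ B → Btw n x w y) : False := by
  have hpos : (y - x).val ≠ 0 := by
    rw [Ne, ZMod.val_eq_zero, sub_eq_zero]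
    exact hxy.symm
  have hlt := ZMod.val_lt (y - x)
  obtain ⟨k, hk⟩ : ∃ k, (y - x).val = k + 1 := ⟨(y - x).val - 1, by omega⟩
  obtain ⟨m, hm⟩ : ∃ m, n = k + (m + 1) + 1 := ⟨n - (k + 2), by omega⟩
  have hyx : y = x + 1 + (k : ZMod n) := by
    have h := ZMod.natCast_zmod_val (y - x)
    rw [hk] at h
    push_cast at h
    linear_combination -h
  have hlist : arc x n = x :: (arc (x + 1) k ++ y :: arc (y + 1) m) := by
    refine (congrArg (arc x) hm).trans ?_
    rw [arc_succ, arc_add, arc_succ, ← hyx]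
  have htri := triplewise_btw_arc x le_rfl
  apply hB.not_earReducible x
  rw [hlist] at htri ⊢
  rw [List.triplewise_cons, List.pairwise_append, List.pairwise_cons] at htri
  obtain ⟨⟨-, ⟨hC, -⟩, hA⟩, -⟩ := htri
  refine .fan_append (fun w hw h => ?_) (fun h => (hx y h).ne_left rfl)
    (.rotate (.fan fun w hw h => ?_))
  · have h1 := hA w hw y (by simp)
    have h2 := hx w h
    rw [btw_iff x] at h1 h2
    omega
  · rcases List.mem_append.1 hw with hw | hw
    · have h1 := hC w hw
      have h2 := hy w h
      unfold Btw at h1 h2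
      omega
    · rw [List.mem_singleton] at hw
      subst hw
      exact (hy w h).ne_left rfl

/-- If `f ∈ B` is not an ear-cover, then each arc it cuts off contains an uncovered vertex. -/
theorem IsSaturatedBlocker.exists_uncovered_in_arc (hB : IsSaturatedBlocker n B) {p : ZMod n}
    {k : ℕ} (hk : 2 ≤ k) (hkn : k < n) (hf : s(p, p + (k : ZMod n)) ∈ B)
    (hne : ∀ v, s(p, p + (k : ZMod n)) ≠ s(v - 1, v + 1)) :
    ∃ a, 0 < a ∧ a < k ∧ s(p + (a : ZMod n) - 1, p + (a : ZMod n) + 1) ∉ B := by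
  by_contra! hcon
  obtain ⟨T, hT, hfT, huniq⟩ := hB.exists_triangulation hf
  obtain ⟨i, hi, hiT⟩ := hT.exists_ear k p hk hkn hfT
  have e : s(p + (i : ZMod n), p + ((i + 2 : ℕ) : ZMod n)) =
      s(p + ((i + 1 : ℕ) : ZMod n) - 1, p + ((i + 1 : ℕ) : ZMod n) + 1) := by
    have h1 : p + ((i + 1 : ℕ) : ZMod n) - 1 = p + (i : ZMod n) := by push_cast; ring
    have h2 : p + ((i + 1 : ℕ) : ZMod n) + 1 = p + ((i + 2 : ℕ) : ZMod n) := by push_cast; ring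
    rw [h1, h2]
  have hmem := hcon (i + 1) (by omega) (by omega)
  rw [e] at hiT
  exact hne _ (huniq _ hmem hiT).symm

end Blockers

section UniqueNeighbours

variable {n : ℕ} {B : Finset (Sym2 (ZMod n))}

theorem exists_uncovered_succ {p : ZMod n} (hp : s(p - 1, p + 1) ∈ B) {m : ℕ}
    (hm : s(p + (m : ZMod n) - 1, p + (m : ZMod n) + 1) ∉ B) :
    ∃ a, 0 < a ∧ a ≤ m ∧ s(p + (a : ZMod n) - 1, p + (a : ZMod n) + 1) ∉ B ∧
      s(p + (a : ZMod n) - 1 - 1, p + (a : ZMod n) - 1 + 1) ∈ B := by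
  induction m with
  | zero => exact absurd hp (by simpa using hm)
  | succ m ih =>
    by_cases h : s(p + (m : ZMod n) - 1, p + (m : ZMod n) + 1) ∈ B
    · refine ⟨m + 1, by omega, le_rfl, hm, ?_⟩
      have e : p + ((m + 1 : ℕ) : ZMod n) - 1 = p + (m : ZMod n) := by push_cast; ring
      rwa [e]
    · obtain ⟨a, h1, h2, h3⟩ := ih h
      exact ⟨a, h1, by omega, h3⟩

theorem exists_uncovered_pred {p : ZMod n} (hp : s(p - 1, p + 1) ∈ B) {m : ℕ}
    (hm : s(p - (m : ZMod n) - 1, p - (m : ZMod n) + 1) ∉ B) :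
    ∃ i : ZMod n, s(i - 1, i + 1) ∉ B ∧ s(i + 1 - 1, i + 1 + 1) ∈ B := by
  induction m with
  | zero => exact absurd hp (by simpa using hm)
  | succ m ih =>
    by_cases h : s(p - (m : ZMod n) - 1, p - (m : ZMod n) + 1) ∈ B
    · refine ⟨_, hm, ?_⟩
      have e : p - ((m + 1 : ℕ) : ZMod n) + 1 = p - (m : ZMod n) := by push_cast; ring
      rwa [e]
    · exact ih h

theorem ear_injective (hn : 5 ≤ n) :
    Function.Injective fun v : ZMod n => s(v - 1, v + 1) := by
  intro v w h
  have h4 : ((4 : ℕ) : ZMod n) ≠ 0 := by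
    rw [Ne, ZMod.natCast_eq_zero_iff]
    exact fun hd => absurd (Nat.le_of_dvd (by omega) hd) (by omega)
  rcases Sym2.eq_iff.1 h with ⟨h1, -⟩ | ⟨h1, h2⟩
  · exact sub_left_injective h1
  · refine absurd ?_ h4
    push_cast
    linear_combination h2 - h1

variable [NeZero n]

/-- If every uncovered vertex has a single neighbour, then an edge of `B` joining two covered
vertices is an ear-cover. -/
theorem IsSaturatedBlocker.exists_eq_ear (hB : IsSaturatedBlocker n B)
    (huniq : ∀ v, s(v - 1, v + 1) ∉ B → ∃ j, s(v, j) ∈ B ∧ ∀ w, s(v, w) ∈ B → w = j)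
    {p q : ZMod n} (hpq : s(p, q) ∈ B) (hp : s(p - 1, p + 1) ∈ B) (hq : s(q - 1, q + 1) ∈ B) :
    ∃ v, s(p, q) = s(v - 1, v + 1) := by
  by_contra! hne
  have hback : ∀ g, s(g - 1, g + 1) ∉ B → s(g - 1 - 1, g - 1 + 1) ∈ B →
      (∀ w, s(g, w) ∈ B → w = g - 2) ∧ s(g - 2 - 1, g - 2 + 1) ∈ B := by
    intro g hg hg'
    obtain ⟨j, hj, hju⟩ := huniq g hg
    have hmem : s(g, g - 2) ∈ B := by
      rwa [Sym2.eq_swap, show g - 1 + 1 = g by ring, show g - 1 - 1 = g - 2 by ring] at hg'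
    obtain rfl := hju _ hmem
    exact ⟨hju, hB.covers_of_unique hj hju⟩
  have hfirst : ∀ p q : ZMod n, s(p, q) ∈ B → s(p - 1, p + 1) ∈ B →
      (∀ v, s(p, q) ≠ s(v - 1, v + 1)) →
      ∃ a, 0 < a ∧ a < (q - p).val ∧ s(p + (a : ZMod n) - 1, p + (a : ZMod n) + 1) ∉ B ∧
        s(p + (a : ZMod n) - 1 - 1, p + (a : ZMod n) - 1 + 1) ∈ B := by
    intro p q hpq hp hne
    have hk := hB.two_le_val_sub hpq
    have hqp : q = p + ((q - p).val : ZMod n) := by simp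
    rw [hqp] at hpq hne
    obtain ⟨m, -, hmk, hm⟩ := hB.exists_uncovered_in_arc hk.1 (by omega) hpq hne
    obtain ⟨a, h1, h2, h3⟩ := exists_uncovered_succ hp hm
    exact ⟨a, h1, by omega, h3⟩
  obtain ⟨a, ha, haq, hx, hx'⟩ := hfirst p q hpq hp hne
  obtain ⟨b, hb, hbp, hy, hy'⟩ := hfirst q p (by rwa [Sym2.eq_swap]) hq (by rwa [Sym2.eq_swap])
  have hsum : ∀ p q : ZMod n, p ≠ q → (q - p).val + (p - q).val = n := by
    intro p q hpq
    have : NeZero (q - p) := ⟨sub_ne_zero.2 hpq.symm⟩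
    have hlt := ZMod.val_lt (q - p)
    rw [← neg_sub q p, ZMod.val_neg_of_ne_zero]
    omega
  have hpq_ne : p ≠ q := by
    rintro rfl
    simp at haq
  have hsep : ∀ (p q : ZMod n) (a b : ℕ), p ≠ q → 0 < b → a < (q - p).val → b < (p - q).val →
      q + (b : ZMod n) - 2 ≠ p + (a : ZMod n) →
      Btw n (p + (a : ZMod n)) (q + (b : ZMod n) - 2) (q + (b : ZMod n)) := by
    intro p q a b hpq hb ha hbp hne
    have hs := hsum p q hpq
    obtain ⟨t, ht⟩ : ∃ t, (q - p).val + b = t + 2 := ⟨(q - p).val + b - 2, by omega⟩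
    have e1 : q + (b : ZMod n) = p + ((t + 2 : ℕ) : ZMod n) := by
      rw [← ht]
      push_cast
      rw [ZMod.natCast_zmod_val]
      ring
    have e2 : q + (b : ZMod n) - 2 = p + (t : ZMod n) := by
      rw [e1]
      push_cast
      ring
    rw [e2] at hne ⊢
    rw [e1]
    have hat : a ≠ t := by
      rintro rfl
      exact hne rfl
    exact btw_add_natCast (by omega) (by omega) (by omega)
  obtain ⟨hxu, hxc⟩ := hback _ hx hx'
  obtain ⟨hyu, hyc⟩ := hback _ hy hy'
  have hbx := hsep q p b a hpq_ne.symm ha hbp haq fun h => hy (by rwa [h] at hxc)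
  have hby := hsep p q a b hpq_ne hb haq hbp fun h => hx (by rwa [h] at hyc)
  exact hB.1.false_of_opposite_sides hby.ne_ends
    (fun w hw => hxu w hw ▸ hbx) (fun w hw => hyu w hw ▸ hby)

end UniqueNeighbours

end ConvexBlocker

open ConvexBlocker in
/-- any saturated blocker of size `n-1` of the convex `n`-gon (`n ≥ 6`) has a
vertex `i` of degree `2` not covered by an ear-cover of the blocker. -/
theorem exists_uncovered_vertex_of_degree_two
    (n : ℕ) (hn : 6 ≤ n) (B : Finset (Sym2 (ZMod n)))
    (hB : IsSaturatedBlocker n B) (hcard : B.card = n - 1) :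
    ∃ i : ZMod n, degB n B i = 2 ∧ s(i - 1, i + 1) ∉ B := by
  classical
  have : NeZero n := ⟨by omega⟩
  by_contra! hcon
  have huniq : ∀ v, s(v - 1, v + 1) ∉ B → ∃ j, s(v, j) ∈ B ∧ ∀ w, s(v, w) ∈ B → w = j := by
    intro v hv
    obtain ⟨j, hj⟩ := hB.1.exists_mem v
    refine ⟨j, hj, fun w hw => ?_⟩
    have hle := hB.1.degB_add_le (by omega) hv
    have hne : degB n B v ≠ 2 := fun h => hv (hcon v h)
    have hone : degB n B v ≤ 1 := by omega
    unfold degB at hone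
    have h : s(v, w) = s(v, j) :=
      Finset.card_le_one.1 hone s(v, w) (by simp [hw]) s(v, j) (by simp [hj])
    exact Sym2.congr_right.1 h
  choose! J hJ hJu using huniq
  set C : Finset (ZMod n) := Finset.univ.filter fun v => s(v - 1, v + 1) ∈ B with hC
  set U : Finset (ZMod n) := Finset.univ.filter fun v => s(v - 1, v + 1) ∉ B with hU
  set E : Finset (Sym2 (ZMod n)) := C.image fun v => s(v - 1, v + 1) with hE
  have hEcard : E.card = C.card := Finset.card_image_of_injective _ (ear_injective (by omega))
  have hCU : C.card + U.card = n := by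
    have h := Finset.card_filter_add_card_filter_not (s := Finset.univ)
      fun v : ZMod n => s(v - 1, v + 1) ∈ B
    rwa [Finset.card_univ, ZMod.card] at h
  have hEB : E ⊆ B := by
    intro e he
    obtain ⟨v, hv, rfl⟩ := Finset.mem_image.1 he
    exact (Finset.mem_filter.1 hv).2
  have hEle := Finset.card_le_card hEB
  have hmemE : ∀ v, s(v - 1, v + 1) ∈ B → s(v - 1, v + 1) ∈ E := fun v hv =>
    Finset.mem_image.2 ⟨v, Finset.mem_filter.2 ⟨Finset.mem_univ _, hv⟩, rfl⟩
  obtain ⟨x, hx⟩ : U.Nonempty := Finset.card_pos.1 (by omega)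
  have hx := (Finset.mem_filter.1 hx).2
  have hc := hB.covers_of_unique (hJ x hx) (hJu x hx)
  obtain ⟨a, -, -, hg, hg'⟩ := exists_uncovered_succ (m := (x - J x).val) hc (by simpa using hx)
  obtain ⟨i, hi, hi'⟩ := exists_uncovered_pred (m := (J x - x).val) hc (by simpa using hx)
  set g := J x + (a : ZMod n)
  have hgJ : s(g, J g) = s(g - 1 - 1, g - 1 + 1) := by
    have h := hJu g hg (g - 1 - 1) (by rwa [Sym2.eq_swap, sub_add_cancel] at hg')
    rw [← h, Sym2.eq_swap, sub_add_cancel]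
  have hiJ : s(i, J i) = s(i + 1 - 1, i + 1 + 1) := by
    have h := hJu i hi (i + 1 + 1) (by rwa [add_sub_cancel_right] at hi')
    rw [← h, add_sub_cancel_right]
  have hgi : g ≠ i := by
    intro h
    rw [h] at hgJ
    have h2 : i - 1 = i + 1 := ear_injective (by omega) (hgJ.symm.trans hiJ)
    have h3 : ((2 : ℕ) : ZMod n) ≠ 0 := by
      rw [Ne, ZMod.natCast_eq_zero_iff]
      exact fun hd => absurd (Nat.le_of_dvd (by omega) hd) (by omega)
    refine h3 ?_
    push_cast
    linear_combination -h2
  have hsub : B \ E ⊆ ((U.erase i).erase g).image fun v => s(v, J v) := by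
    intro f hf
    rw [Finset.mem_sdiff] at hf
    obtain ⟨hfB, hfE⟩ := hf
    have hkey : ∀ v w, s(v, w) ∈ B → s(v, w) ∉ E → s(v - 1, v + 1) ∉ B →
        s(v, w) ∈ ((U.erase i).erase g).image fun v => s(v, J v) := by
      intro v w hvw hvwE hv
      obtain rfl := hJu v hv w hvw
      refine Finset.mem_image.2 ⟨v, ?_, rfl⟩
      rw [Finset.mem_erase, Finset.mem_erase]
      refine ⟨?_, ?_, Finset.mem_filter.2 ⟨Finset.mem_univ _, hv⟩⟩
      · rintro rfl
        exact hvwE (hgJ ▸ hmemE _ hg')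
      · rintro rfl
        exact hvwE (hiJ ▸ hmemE _ hi')
    induction f with | _ p q
    by_cases hp : s(p - 1, p + 1) ∈ B
    · by_cases hq : s(q - 1, q + 1) ∈ B
      · obtain ⟨v, hv⟩ := hB.exists_eq_ear (fun v hv => ⟨J v, hJ v hv, hJu v hv⟩) hfB hp hq
        rw [hv] at hfB hfE
        exact absurd (hmemE v hfB) hfE
      · rw [Sym2.eq_swap] at hfB hfE ⊢
        exact hkey q p hfB hfE hq
    · exact hkey p q hfB hfE hp
  have hle := (Finset.card_le_card hsub).trans Finset.card_image_le
  rw [Finset.card_sdiff_of_subset hEB] at hle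
  have hiU : i ∈ U := Finset.mem_filter.2 ⟨Finset.mem_univ _, hi⟩
  have hgU : g ∈ U.erase i :=
    Finset.mem_erase.2 ⟨hgi, Finset.mem_filter.2 ⟨Finset.mem_univ _, hg⟩⟩
  have h1 := Finset.card_erase_add_one hiU
  have h2 := Finset.card_erase_add_one hgU
  omega
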